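/- Let Σ be a finite alphabet and let S₁, S₂, …, S_m ∈ Σ^∞ be finitely many sequences. Then there exists a single increasing sequence of natural numbers n₁ < n₂ < n₃ < … such that for every i ∈ {1,…,m}, the sequence T_i = S_i[0…n₁]S_i[0…n₂]S_i[0…n₃]… satisfies dim_FS(T_i) = dim_FS(S_i). -/

import Mathlib

/-- Number of sliding-block occurrences of `w` in `s`:
`N(w,s) = |{i : s[i…i+|w|−1] = w}|`. -/
def slideN {α : Type*} [DecidableEq α] (w s : List α) : ℕ :=
  ((Finset.range (s.length + 1 - w.length)).filter
    (fun i => ((s.drop i).take w.length) = w)).card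

/-- Sliding count probability of `w` in `s`: `P(w,s) = N(w,s)/(|s|−|w|+1)`. -/
noncomputable def slideP {α : Type*} [DecidableEq α] (w s : List α) : ℝ :=
  (slideN w s : ℝ) / ((s.length : ℝ) - (w.length : ℝ) + 1)

/-- `l`-th sliding block entropy of a string, with logarithms base `|α|`.
The convention `0 · log(1/0) = 0` holds automatically since `Real.logb b 0⁻¹ = 0`. -/
noncomputable def slideH {α : Type*} [Fintype α] [DecidableEq α] (l : ℕ) (x : List α) : ℝ :=
  (1 / (l : ℝ)) * ∑ w : Fin l → α,
    slideP (List.ofFn w) x * Real.logb (Fintype.card α) (slideP (List.ofFn w) x)⁻¹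

/-- The prefix `S[0…n]` of a sequence, i.e. its first `n+1` symbols. -/
def pre {α : Type*} (S : ℕ → α) (n : ℕ) : List α := List.ofFn (fun i : Fin (n + 1) => S i)

/-- Finite-state dimension via sliding block entropies:
`dim_FS(S) = inf_{l ≥ 1} liminf_{n→∞} H_l(S[0…n])`. -/
noncomputable def dimFS {α : Type*} [Fintype α] [DecidableEq α] (S : ℕ → α) : ℝ :=
  ⨅ l : ℕ, Filter.liminf (fun n => slideH (l + 1) (pre S n)) Filter.atTop

/-- Finite-state strong dimension:
`Dim_FS(S) = inf_{l ≥ 1} limsup_{n→∞} H_l(S[0…n])`. -/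
noncomputable def DimFS {α : Type*} [Fintype α] [DecidableEq α] (S : ℕ → α) : ℝ :=
  ⨅ l : ℕ, Filter.limsup (fun n => slideH (l + 1) (pre S n)) Filter.atTop
/-- Cumulative lengths of a sequence of lists. -/
def cumLen {α : Type*} (L : ℕ → List α) : ℕ → ℕ
  | 0 => 0
  | m + 1 => cumLen L m + (L m).length

open scoped Classical in
/-- The infinite sequence obtained by concatenating the lists `L 0, L 1, L 2, …`
(a default symbol is used in the degenerate case where the total length is finite). -/
noncomputable def concatSeq {α : Type*} (dflt : α) (L : ℕ → List α) (k : ℕ) : α :=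
  if h : ∃ m, k < cumLen L (m + 1) then
    (L (Nat.find h)).getD (k - cumLen L (Nat.find h)) dflt
  else dflt

open Filter Topology

/-- The number of positions `i < N` at which the word `w` occurs in the sequence `S`. -/
def windowCount {α : Type*} [DecidableEq α] {l : ℕ} (S : ℕ → α) (N : ℕ) (w : Fin l → α) : ℕ :=
  Nat.count (fun i => (fun j : Fin l => S (i + j)) = w) N

/-- The sum of `φ` over the relative frequencies `c N w / N`. -/
noncomputable def freqSum {W : Type*} [Fintype W] (φ : ℝ → ℝ) (c : ℕ → W → ℕ) (N : ℕ) : ℝ :=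
  ∑ w, φ ((c N w : ℝ) / N)

/-- The summand of the block entropy of block length `l`. -/
noncomputable def entropyTerm (b l : ℕ) (x : ℝ) : ℝ :=
  (1 / (l : ℝ)) * (x * Real.logb b x⁻¹)

lemma entropyTerm_eq (b l : ℕ) (x : ℝ) :
    entropyTerm b l x = (1 / (l : ℝ) * (Real.log b)⁻¹) * Real.negMulLog x := by
  simp only [entropyTerm, Real.logb, Real.log_inv, Real.negMulLog]
  ring

lemma entropyTerm_coeff_nonneg (b l : ℕ) : 0 ≤ 1 / (l : ℝ) * (Real.log b)⁻¹ :=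
  mul_nonneg (by positivity) (inv_nonneg.2 (Real.log_natCast_nonneg b))

lemma concaveOn_entropyTerm (b l : ℕ) : ConcaveOn ℝ (Set.Icc 0 1) (entropyTerm b l) := by
  have h := (Real.concaveOn_negMulLog.subset Set.Icc_subset_Ici_self (convex_Icc (0 : ℝ) 1)).smul
    (entropyTerm_coeff_nonneg b l)
  refine h.congr fun x _ => ?_
  simp [entropyTerm_eq]

lemma continuous_entropyTerm (b l : ℕ) : Continuous (entropyTerm b l) := by
  have h : entropyTerm b l = fun x => (1 / (l : ℝ) * (Real.log b)⁻¹) * Real.negMulLog x :=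
    funext (entropyTerm_eq b l)
  rw [h]
  exact continuous_const.mul Real.continuous_negMulLog

lemma entropyTerm_nonneg (b l : ℕ) {x : ℝ} (hx : x ∈ Set.Icc (0 : ℝ) 1) :
    0 ≤ entropyTerm b l x := by
  rw [entropyTerm_eq]
  exact mul_nonneg (entropyTerm_coeff_nonneg b l) (Real.negMulLog_nonneg hx.1 hx.2)

lemma drop_take_pre_eq_iff {α : Type*} {l : ℕ} (S : ℕ → α) (w : Fin l → α) {n i : ℕ}
    (h : i + l ≤ n + 1) :
    ((pre S n).drop i).take l = List.ofFn w ↔ (fun j : Fin l => S (i + j)) = w := by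
  have hs : ((pre S n).drop i).take l = List.ofFn (fun j : Fin l => S (i + j)) := by
    apply List.ext_getElem
    · simp [pre]; omega
    · intro j _ _
      simp [pre, -List.ofFn_succ]
  rw [hs]
  exact List.ofFn_injective.eq_iff

lemma slideN_pre {α : Type*} [DecidableEq α] {l : ℕ} (S : ℕ → α) (w : Fin l → α) (n : ℕ) :
    slideN (List.ofFn w) (pre S n) = windowCount S (n + 2 - l) w := by
  simp only [slideN, windowCount, Nat.count_eq_card_filter_range]
  have hlen : (pre S n).length = n + 1 := by simp [pre]
  rw [hlen, List.length_ofFn]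
  congr 1
  refine Finset.filter_congr fun i hi => ?_
  rw [Finset.mem_range] at hi
  exact drop_take_pre_eq_iff S w (by omega)

lemma slideH_pre {α : Type*} [Fintype α] [DecidableEq α] (l : ℕ) (S : ℕ → α) (n : ℕ) :
    slideH (l + 1) (pre S (n + l)) =
      freqSum (entropyTerm (Fintype.card α) (l + 1))
        (fun N (w : Fin (l + 1) → α) => windowCount S N w) (n + 1) := by
  simp only [slideH, freqSum, entropyTerm, Finset.mul_sum]
  refine Finset.sum_congr rfl fun w _ => ?_
  have hP : slideP (List.ofFn w) (pre S (n + l)) =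
      (windowCount S (n + 1) w : ℝ) / ((n + 1 : ℕ) : ℝ) := by
    rw [slideP, slideN_pre, show n + l + 2 - (l + 1) = n + 1 by omega]
    congr 1
    simp [pre]
  rw [hP]

lemma dimFS_eq_iInf_freqSum {α : Type*} [Fintype α] [DecidableEq α] (S : ℕ → α) :
    dimFS S = ⨅ l : ℕ, liminf (freqSum (entropyTerm (Fintype.card α) (l + 1))
      (fun N (w : Fin (l + 1) → α) => windowCount S N w)) atTop := by
  refine iInf_congr fun l => ?_
  rw [← liminf_nat_add _ l, ← liminf_nat_add (freqSum _ _) 1]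
  simp only [slideH_pre]

lemma windowCount_le {α : Type*} [DecidableEq α] {l : ℕ} (S : ℕ → α) (N : ℕ) (w : Fin l → α) :
    windowCount S N w ≤ N := Nat.count_le _

lemma count_le_count_add (p q : ℕ → Prop) [DecidablePred p] [DecidablePred q] (l m : ℕ)
    (h : ∀ i, i + l ≤ m → p i → q i) : Nat.count p m ≤ Nat.count q m + l := by
  rcases le_total m l with hml | hml
  · exact (Nat.count_le _).trans (by omega)
  · obtain ⟨r, rfl⟩ := Nat.exists_eq_add_of_le' hml
    rw [Nat.count_add]
    have h1 : Nat.count p r ≤ Nat.count q r := by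
      rw [Nat.count_eq_card_filter_range, Nat.count_eq_card_filter_range]
      refine Finset.card_le_card fun i hi => ?_
      simp only [Finset.mem_filter, Finset.mem_range] at hi ⊢
      exact ⟨hi.1, h i (by omega) hi.2⟩
    have h2 : Nat.count (fun k => p (r + k)) l ≤ l := Nat.count_le _
    have h3 : Nat.count q r ≤ Nat.count q (r + l) := Nat.count_monotone q (by omega)
    omega

/-- If `T` agrees with `S` on a block of length `L` starting at `M`, then the word counts of `T`
along this block are those of `S` up to the block length. -/
lemma abs_windowCount_sub_le {α : Type*} [DecidableEq α] {l : ℕ} (S T : ℕ → α) {M L m : ℕ}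
    (hST : ∀ i < L, T (M + i) = S i) (hm : m ≤ L) (w : Fin l → α) :
    |(windowCount T (M + m) w : ℝ) - windowCount T M w - windowCount S m w| ≤ l := by
  have key : ∀ i, i + l ≤ m →
      (((fun j : Fin l => T (M + i + j)) = w) ↔ ((fun j : Fin l => S (i + j)) = w)) := by
    intro i hi
    have : (fun j : Fin l => T (M + i + j)) = (fun j : Fin l => S (i + j)) := by
      funext j
      rw [add_assoc]
      exact hST _ (by omega)
    rw [this]
  have h1 := count_le_count_add _ _ l m fun i hi => (key i hi).1
  have h2 := count_le_count_add _ _ l m fun i hi => (key i hi).2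
  simp only [windowCount]
  rw [Nat.count_add, abs_le]
  push_cast
  have h1' : (Nat.count (fun i => (fun j : Fin l => T (M + i + j)) = w) m : ℝ) ≤
      Nat.count (fun i => (fun j : Fin l => S (i + j)) = w) m + l := by exact_mod_cast h1
  have h2' : (Nat.count (fun i => (fun j : Fin l => S (i + j)) = w) m : ℝ) ≤
      Nat.count (fun i => (fun j : Fin l => T (M + i + j)) = w) m + l := by exact_mod_cast h2
  constructor <;> linarith

lemma cumLen_mono {α : Type*} (L : ℕ → List α) : Monotone (cumLen L) :=
  monotone_nat_of_le_succ fun k => by simp [cumLen]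

lemma concatSeq_cumLen_add {α : Type*} (dflt : α) (L : ℕ → List α) {k i : ℕ}
    (hi : i < (L k).length) : concatSeq dflt L (cumLen L k + i) = (L k)[i] := by
  classical
  have hlt : cumLen L k + i < cumLen L (k + 1) := by simp [cumLen, hi]
  have h : ∃ m, cumLen L k + i < cumLen L (m + 1) := ⟨k, hlt⟩
  have hfind : Nat.find h = k := by
    rw [Nat.find_eq_iff]
    refine ⟨hlt, fun j hj => ?_⟩
    have := cumLen_mono L (Nat.succ_le_of_lt hj)
    simp only [Nat.succ_eq_add_one] at this
    omega
  rw [concatSeq, dif_pos (by convert h)]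
  have e : ∀ j, j = k → (L j).getD (cumLen L k + i - cumLen L j) dflt = (L k)[i] := by
    rintro j rfl
    simp [hi]
  exact e _ (by convert hfind)

lemma concatSeq_pre {α : Type*} (dflt : α) (S : ℕ → α) (n : ℕ → ℕ) {k i : ℕ}
    (hi : i < n k + 1) :
    concatSeq dflt (fun j => pre S (n j)) (cumLen (fun j => pre S (n j)) k + i) = S i := by
  rw [concatSeq_cumLen_add dflt (fun j => pre S (n j)) (by simpa [pre] using hi)]
  simp [pre, -List.ofFn_succ]

lemma div_mem_Icc_of_le {a b : ℝ} (ha : 0 ≤ a) (hab : a ≤ b) : a / b ∈ Set.Icc (0 : ℝ) 1 :=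
  ⟨div_nonneg ha (ha.trans hab), div_le_one_of_le₀ hab (ha.trans hab)⟩

lemma freq_mem_Icc {W : Type*} {c : ℕ → W → ℕ} (hc : ∀ N w, c N w ≤ N) (N : ℕ) (w : W) :
    (c N w : ℝ) / N ∈ Set.Icc (0 : ℝ) 1 :=
  div_mem_Icc_of_le (by positivity) (by exact_mod_cast hc N w)

section FreqSum

variable {W : Type*} [Fintype W] {φ : ℝ → ℝ} {c d : ℕ → W → ℕ}

lemma freqSum_nonneg (hφ : ∀ x ∈ Set.Icc (0 : ℝ) 1, 0 ≤ φ x) (hc : ∀ N w, c N w ≤ N) (N : ℕ) :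
    0 ≤ freqSum φ c N :=
  Finset.sum_nonneg fun w _ => hφ _ (freq_mem_Icc hc N w)

lemma exists_freqSum_le (hφ : Continuous φ) (hc : ∀ N w, c N w ≤ N) :
    ∃ C, ∀ N, freqSum φ c N ≤ C := by
  obtain ⟨B, hB⟩ := (isCompact_Icc (a := (0 : ℝ)) (b := 1)).bddAbove_image hφ.continuousOn
  exact ⟨∑ _w : W, B, fun N => Finset.sum_le_sum fun w _ =>
    hB ⟨_, freq_mem_Icc hc N w, rfl⟩⟩

lemma exists_delta_abs_sum_sub_le (hφ : Continuous φ) {ε : ℝ} (hε : 0 < ε) :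
    ∃ δ > 0, ∀ p q : W → ℝ, (∀ w, p w ∈ Set.Icc (0 : ℝ) 1) → (∀ w, q w ∈ Set.Icc (0 : ℝ) 1) →
      (∀ w, |p w - q w| < δ) → |∑ w, φ (p w) - ∑ w, φ (q w)| ≤ ε := by
  have huc := (isCompact_Icc (a := (0 : ℝ)) (b := 1)).uniformContinuousOn_of_continuous
    hφ.continuousOn
  rw [Metric.uniformContinuousOn_iff] at huc
  obtain ⟨δ, hδ, h⟩ := huc (ε / (Fintype.card W + 1)) (by positivity)
  refine ⟨δ, hδ, fun p q hp hq hpq => ?_⟩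
  rw [← Finset.sum_sub_distrib]
  refine (Finset.abs_sum_le_sum_abs _ _).trans ?_
  have hle : ∀ w ∈ Finset.univ, |φ (p w) - φ (q w)| ≤ ε / (Fintype.card W + 1) := fun w _ =>
    (h _ (hp w) _ (hq w) (hpq w)).le
  refine (Finset.sum_le_card_nsmul _ _ _ hle).trans ?_
  rw [nsmul_eq_mul, Finset.card_univ, mul_div_assoc', div_le_iff₀ (by positivity)]
  nlinarith

lemma abs_div_sub_div_lt {x y a b r δ : ℝ} (hy : 0 ≤ y) (hyb : y ≤ b) (hb : 0 < b) (hba : b ≤ a)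
    (hxy : |x - y| ≤ r) (h : r + (a - b) < δ * a) : |x / a - y / b| < δ := by
  have ha : 0 < a := hb.trans_le hba
  have e : x / a - y / b = ((x - y) - (y / b) * (a - b)) / a := by
    field_simp
    ring
  have hyb1 : y / b ≤ 1 := div_le_one_of_le₀ hyb hb.le
  have hyb0 : 0 ≤ y / b := by positivity
  rw [e, abs_div, abs_of_pos ha, div_lt_iff₀ ha]
  refine lt_of_le_of_lt (abs_sub _ _) (lt_of_le_of_lt (add_le_add hxy ?_) h)
  rw [abs_of_nonneg (mul_nonneg hyb0 (by linarith))]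
  nlinarith

lemma concave_mul_div_add_le (hφ : ConcaveOn ℝ (Set.Icc 0 1) φ) {x y : ℝ} {L m : ℕ} (hL : 0 < L)
    (hx : 0 ≤ x) (hxL : x ≤ L) (hy : 0 ≤ y) (hym : y ≤ m) :
    L * φ (x / L) + m * φ (y / m) ≤ (L + m) * φ ((x + y) / (L + m)) := by
  have hL' : (0 : ℝ) < L := by exact_mod_cast hL
  have hs : (0 : ℝ) < L + m := by positivity
  have ha : (0 : ℝ) ≤ L / (L + m) := by positivity
  have hb : (0 : ℝ) ≤ m / (L + m) := by positivity
  have hab : (L : ℝ) / (L + m) + m / (L + m) = 1 := by rw [← add_div, div_self hs.ne']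
  have h := hφ.2 (div_mem_Icc_of_le hx hxL) (div_mem_Icc_of_le hy hym) ha hb hab
  have e : ((L : ℝ) / (L + m)) • (x / L) + ((m : ℝ) / (L + m)) • (y / m) =
      (x + y) / (L + m) := by
    have : (m : ℝ) * (y / m) = y := by
      rcases Nat.eq_zero_or_pos m with rfl | hm
      · simp only [Nat.cast_zero] at hym ⊢
        linarith
      · have : (m : ℝ) ≠ 0 := by positivity
        field_simp
    simp only [smul_eq_mul]
    rw [div_mul_eq_mul_div, div_mul_eq_mul_div, this, mul_div_cancel₀ _ hL'.ne', ← add_div]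
  rw [e] at h
  simp only [smul_eq_mul] at h
  have h' := mul_le_mul_of_nonneg_left h hs.le
  refine le_trans (le_of_eq ?_) h'
  field_simp

lemma mul_sub_le_mul_freqSum (hφ : ∀ x ∈ Set.Icc (0 : ℝ) 1, 0 ≤ φ x) (hc : ∀ N w, c N w ≤ N)
    {a : ℝ} {N₀ : ℕ} (ha : ∀ N, N₀ ≤ N → a ≤ freqSum φ c N) (N : ℕ) :
    N * a - N₀ * |a| ≤ N * freqSum φ c N := by
  have h0 := freqSum_nonneg hφ hc N
  rcases le_total N₀ N with h | h
  · have := mul_le_mul_of_nonneg_left (ha N h) (Nat.cast_nonneg (α := ℝ) N)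
    have : 0 ≤ N₀ * |a| := by positivity
    linarith
  · have h1 : (N : ℝ) * a ≤ N * |a| := by gcongr; exact le_abs_self a
    have h2 : (N : ℝ) * |a| ≤ N₀ * |a| := by gcongr
    have h3 : 0 ≤ N * freqSum φ c N := by positivity
    linarith

lemma mul_sub_le_mul_sum_of_concave (hφ : ConcaveOn ℝ (Set.Icc 0 1) φ)
    (hφ0 : ∀ x ∈ Set.Icc (0 : ℝ) 1, 0 ≤ φ x) (hc : ∀ N w, c N w ≤ N)
    {a : ℝ} {N₀ : ℕ} (ha : ∀ N, N₀ ≤ N → a ≤ freqSum φ c N) {L : ℕ} (hL : 0 < L) (m : ℕ) :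
    (L + m) * a - 2 * N₀ * |a| ≤
      (L + m) * ∑ w, φ (((c L w : ℝ) + c m w) / (L + m)) := by
  have h1 := mul_sub_le_mul_freqSum hφ0 hc ha L
  have h2 := mul_sub_le_mul_freqSum hφ0 hc ha m
  have h3 : L * freqSum φ c L + m * freqSum φ c m ≤
      (L + m) * ∑ w, φ (((c L w : ℝ) + c m w) / (L + m)) := by
    simp only [freqSum, Finset.mul_sum, ← Finset.sum_add_distrib]
    exact Finset.sum_le_sum fun w _ => concave_mul_div_add_le hφ hL (by positivity)
      (by exact_mod_cast hc L w) (by positivity) (by exact_mod_cast hc m w)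
  linarith

variable {M n : ℕ → ℕ} {l : ℕ}

lemma exists_block (hM0 : M 0 = 0) (hM : ∀ k, M (k + 1) = M k + (n k + 1)) (N : ℕ) :
    ∃ k m, N = M k + m ∧ m ≤ n k := by
  have hlt : ∃ k, N < M (k + 1) := by
    have : ∀ k, k ≤ M k := by
      intro k
      induction k with
      | zero => omega
      | succ k ih => have := hM k; omega
    exact ⟨N, this (N + 1)⟩
  classical
  have h1 := Nat.find_spec hlt
  have h2 : M (Nat.find hlt) ≤ N := by
    rcases hk : Nat.find hlt with _ | k
    · omega
    · have := Nat.find_min hlt (m := k) (by omega)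
      omega
  have := hM (Nat.find hlt)
  exact ⟨Nat.find hlt, N - M (Nat.find hlt), by omega, by omega⟩

/-- Asymptotic lower bound for the frequency sums of a concatenation of prefixes. -/
lemma eventually_sub_le_freqSum (hφc : ConcaveOn ℝ (Set.Icc 0 1) φ) (hφ : Continuous φ)
    (hφ0 : ∀ x ∈ Set.Icc (0 : ℝ) 1, 0 ≤ φ x) (hc : ∀ N w, c N w ≤ N) (hd : ∀ N w, d N w ≤ N)
    (hM0 : M 0 = 0) (hM : ∀ k, M (k + 1) = M k + (n k + 1)) (hn : StrictMono n)
    (hMn : ∀ k, M k * k ≤ n k)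
    (hcd : ∀ k m w, m ≤ n k + 1 → |(d (M k + m) w : ℝ) - d (M k) w - c m w| ≤ l)
    {a ε : ℝ} (hε : 0 < ε) (ha : ∀ᶠ N in atTop, a ≤ freqSum φ c N) :
    ∀ᶠ N in atTop, a - 2 * ε ≤ freqSum φ d N := by
  obtain ⟨N₀, hN₀⟩ := eventually_atTop.1 ha
  obtain ⟨δ, hδ, hcont⟩ := exists_delta_abs_sum_sub_le (W := W) hφ hε
  obtain ⟨J, hJ⟩ := exists_nat_gt (max ((4 + 4 * l) / δ) (2 * N₀ * |a| / ε))
  have hJ1 := (div_lt_iff₀ hδ).1 ((le_max_left _ _).trans_lt hJ)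
  have hJ2 := (div_lt_iff₀ hε).1 ((le_max_right _ _).trans_lt hJ)
  have hMmono : Monotone M := monotone_nat_of_le_succ fun k => by have := hM k; omega
  refine eventually_atTop.2 ⟨M (J + 2), fun N hN => ?_⟩
  obtain ⟨k, m, rfl, hm⟩ := exists_block hM0 hM N
  have hkJ : J + 2 ≤ k + 1 := by
    by_contra! hlt
    have h1 : M (k + 1) ≤ M (J + 2) := hMmono hlt.le
    have := hM k
    omega
  obtain ⟨j, rfl⟩ : ∃ j, k = j + 1 := ⟨k - 1, by omega⟩
  have hjJ : J ≤ j := by omega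
  have hjR : (J : ℝ) ≤ j := by exact_mod_cast hjJ
  have hjn : (j : ℝ) ≤ n j := by exact_mod_cast hn.id_le j
  have hMjn : (M j : ℝ) * j ≤ n j := by exact_mod_cast hMn j
  have hj0 : (0 : ℝ) ≤ j := by positivity
  set L := n j + 1 with hL
  have hLR : (L : ℝ) = n j + 1 := by push_cast [hL]; ring
  have hcast : ((M (j + 1) + m : ℕ) : ℝ) = M j + (L + m) := by rw [hM, ← hL]; push_cast; ring
  have hsmall : 2 * (M j : ℝ) + 2 * l < δ * (M j + (L + m)) := by
    have h1 : 4 * (M j : ℝ) ≤ δ * n j := by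
      have : (M j : ℝ) * 4 ≤ M j * (j * δ) := by
        gcongr
        have : (J : ℝ) * δ ≤ j * δ := by gcongr
        have : (0 : ℝ) ≤ l := by positivity
        linarith
      nlinarith
    have h2 : 4 * (l : ℝ) < δ * n j := by
      have : (J : ℝ) * δ ≤ n j * δ :=
        mul_le_mul_of_nonneg_right (hjR.trans hjn) hδ.le
      linarith
    have h3 : δ * n j ≤ δ * (M j + (L + m)) := by
      gcongr
      have : (0 : ℝ) ≤ M j := by positivity
      have : (0 : ℝ) ≤ m := by positivity
      linarith
    linarith
  have hLm : (0 : ℝ) < L + m := by rw [hLR]; positivity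
  have hclose : ∀ w, |(d (M (j + 1) + m) w : ℝ) / (M (j + 1) + m : ℕ) -
      ((c L w : ℝ) + c m w) / (L + m)| < δ := by
    intro w
    rw [hcast]
    have hcL : (c L w : ℝ) ≤ L := by exact_mod_cast hc L w
    have hcm : (c m w : ℝ) ≤ m := by exact_mod_cast hc m w
    have hdM : (d (M j) w : ℝ) ≤ M j := by exact_mod_cast hd (M j) w
    have hdM0 : (0 : ℝ) ≤ d (M j) w := by positivity
    have e1 := abs_le.1 (hcd (j + 1) m w (by omega))
    have e2 := abs_le.1 (hcd j L w le_rfl)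
    rw [← hM] at e2
    refine abs_div_sub_div_lt (r := M j + 2 * l) (by positivity) (by linarith) hLm
      (by simp) (abs_le.2 ⟨by linarith, by linarith⟩) (by linarith)
  have hq : ∀ w, ((c L w : ℝ) + c m w) / (L + m) ∈ Set.Icc (0 : ℝ) 1 := fun w =>
    div_mem_Icc_of_le (by positivity)
      (add_le_add (by exact_mod_cast hc L w) (by exact_mod_cast hc m w))
  have hfin := abs_le.1 (hcont _ _ (fun w => freq_mem_Icc hd _ w) hq hclose)
  have hmix := mul_sub_le_mul_sum_of_concave hφc hφ0 hc hN₀ (show 0 < L by omega) m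
  have hεL : 2 * N₀ * |a| ≤ (L + m) * ε := by
    have : (J : ℝ) * ε ≤ (L + m) * ε := by
      gcongr
      have : (0 : ℝ) ≤ m := by positivity
      linarith
    linarith
  have hmix' : a - ε ≤ ∑ w, φ (((c L w : ℝ) + c m w) / (L + m)) := by
    refine le_of_mul_le_mul_left ?_ hLm
    linarith
  have : freqSum φ d (M (j + 1) + m) =
    ∑ w, φ ((d (M (j + 1) + m) w : ℝ) / (M (j + 1) + m : ℕ)) := rfl
  linarith [hfin.1]

/-- Far inside a block, the frequency sum of the concatenation follows that of the prefix. -/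
lemma eventually_freqSum_le_add (hφ : Continuous φ) (hc : ∀ N w, c N w ≤ N)
    (hd : ∀ N w, d N w ≤ N)
    (hcd : ∀ k m w, m ≤ n k + 1 → |(d (M k + m) w : ℝ) - d (M k) w - c m w| ≤ l)
    {ε : ℝ} (hε : 0 < ε) :
    ∀ᶠ k in atTop, ∀ m, M k * k + k ≤ m → m ≤ n k →
      freqSum φ d (M k + m) ≤ freqSum φ c m + ε := by
  obtain ⟨δ, hδ, hcont⟩ := exists_delta_abs_sum_sub_le (W := W) hφ hε
  obtain ⟨J, hJ⟩ := exists_nat_gt ((4 + 4 * l) / δ)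
  have hJ1 := (div_lt_iff₀ hδ).1 hJ
  refine eventually_atTop.2 ⟨J + 1, fun k hk m hkm hmn => ?_⟩
  have hkR : (J : ℝ) + 1 ≤ k := by exact_mod_cast hk
  have hkmR : (M k : ℝ) * k + k ≤ m := by exact_mod_cast hkm
  have hMk : (0 : ℝ) ≤ M k := by positivity
  have hl : (0 : ℝ) ≤ l := by positivity
  have hkδ : 4 + 4 * (l : ℝ) < k * δ := by nlinarith
  have hm0 : (0 : ℝ) < m := by
    have : (0 : ℝ) ≤ M k * k := by positivity
    have : (0 : ℝ) ≤ J := by positivity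
    linarith
  have hsmall : 2 * (M k : ℝ) + l < δ * (M k + m) := by
    have h1 : δ * (M k * k + k) ≤ δ * (M k + m) :=
      mul_le_mul_of_nonneg_left (by linarith) hδ.le
    have h2 : (M k : ℝ) * 4 ≤ M k * (k * δ) := by gcongr; linarith
    nlinarith
  have hclose : ∀ w, |(d (M k + m) w : ℝ) / (M k + m : ℕ) - (c m w : ℝ) / m| < δ := by
    intro w
    have hdM : (d (M k) w : ℝ) ≤ M k := by exact_mod_cast hd (M k) w
    have hdM0 : (0 : ℝ) ≤ d (M k) w := by positivity
    have e1 := abs_le.1 (hcd k m w (by omega))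
    push_cast
    exact abs_div_sub_div_lt (r := M k + l) (by positivity) (by exact_mod_cast hc m w) hm0
      (by simp) (abs_le.2 ⟨by linarith, by linarith⟩) (by linarith)
  have hfin := abs_le.1 (hcont _ _ (fun w => freq_mem_Icc hd _ w) (fun w => freq_mem_Icc hc _ w)
    hclose)
  have h2 := hfin.2
  simp only [freqSum]
  linarith

lemma isBoundedUnder_ge_freqSum (hφ0 : ∀ x ∈ Set.Icc (0 : ℝ) 1, 0 ≤ φ x)
    (hc : ∀ N w, c N w ≤ N) : IsBoundedUnder (· ≥ ·) atTop (freqSum φ c) :=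
  isBoundedUnder_of ⟨0, fun N => freqSum_nonneg hφ0 hc N⟩

lemma isCoboundedUnder_ge_freqSum (hφ : Continuous φ) (hc : ∀ N w, c N w ≤ N) :
    IsCoboundedUnder (· ≥ ·) atTop (freqSum φ c) := by
  obtain ⟨C, hC⟩ := exists_freqSum_le hφ hc
  exact (isBoundedUnder_of ⟨C, hC⟩ : IsBoundedUnder (· ≤ ·) atTop (freqSum φ c)).isCoboundedUnder_ge

lemma liminf_freqSum_concat (hφc : ConcaveOn ℝ (Set.Icc 0 1) φ) (hφ : Continuous φ)
    (hφ0 : ∀ x ∈ Set.Icc (0 : ℝ) 1, 0 ≤ φ x) (hc : ∀ N w, c N w ≤ N) (hd : ∀ N w, d N w ≤ N)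
    (hM0 : M 0 = 0) (hM : ∀ k, M (k + 1) = M k + (n k + 1)) (hn : StrictMono n)
    (hMn : ∀ k, M k * k ≤ n k)
    (hcd : ∀ k m w, m ≤ n k + 1 → |(d (M k + m) w : ℝ) - d (M k) w - c m w| ≤ l)
    (hlow : ∀ᶠ k : ℕ in atTop, ∃ m, M k * k + k ≤ m ∧ m ≤ n k ∧
      freqSum φ c m ≤ liminf (freqSum φ c) atTop + 1 / ((k : ℝ) + 1)) :
    liminf (freqSum φ d) atTop = liminf (freqSum φ c) atTop := by
  apply le_antisymm
  · refine le_of_forall_pos_le_add fun ε hε => ?_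
    refine liminf_le_of_frequently_le ?_ (isBoundedUnder_ge_freqSum hφ0 hd)
    have hlim : ∀ᶠ k : ℕ in atTop, 1 / ((k : ℝ) + 1) < ε / 2 :=
      tendsto_one_div_add_atTop_nhds_zero_nat.eventually (gt_mem_nhds (by positivity))
    have hev := (hlow.and hlim).and
      (eventually_freqSum_le_add hφ hc hd hcd (show 0 < ε / 2 by positivity))
    rw [frequently_atTop]
    intro N
    obtain ⟨k, ⟨⟨⟨m, h1, h2, h3⟩, h4⟩, h5⟩, hk⟩ := (hev.and (eventually_ge_atTop N)).exists
    refine ⟨M k + m, by omega, ?_⟩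
    have := h5 m h1 h2
    linarith
  · refine le_of_forall_pos_le_add fun ε hε => ?_
    have ha : ∀ᶠ N in atTop, liminf (freqSum φ c) atTop - ε / 3 ≤ freqSum φ c N :=
      (eventually_lt_of_lt_liminf (sub_lt_self _ (by positivity))
        (isBoundedUnder_ge_freqSum hφ0 hc)).mono fun _ h => h.le
    have h := le_liminf_of_le (isCoboundedUnder_ge_freqSum hφ hd)
      (eventually_sub_le_freqSum hφc hφ hφ0 hc hd hM0 hM hn hMn hcd
        (show 0 < ε / 3 by positivity) ha)
    linarith

end FreqSum

/-- Finitely many families of eventual targets can be hit along one fast-growing sequence: between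
`M k * k + k` and `n k` there is a point where `e i l` nearly attains its lower limit. -/
lemma exists_fast_growing {ι : Type*} [Fintype ι] (e : ι → ℕ → ℕ → ℝ)
    (hb : ∀ i l, IsCoboundedUnder (· ≥ ·) atTop (e i l)) :
    ∃ n M : ℕ → ℕ, StrictMono n ∧ M 0 = 0 ∧ (∀ k, M (k + 1) = M k + (n k + 1)) ∧
      (∀ k, M k * k ≤ n k) ∧ ∀ i l, ∀ᶠ k : ℕ in atTop, ∃ m, M k * k + k ≤ m ∧ m ≤ n k ∧
        e i l m ≤ liminf (e i l) atTop + 1 / ((k : ℝ) + 1) := by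
  have hex : ∀ i l N, ∃ m, N ≤ m ∧ e i l m < liminf (e i l) atTop + 1 / ((N : ℝ) + 1) :=
    fun i l N => by
      have h := frequently_lt_of_liminf_lt (hb i l)
        (lt_add_of_pos_right _ (show 0 < 1 / ((N : ℝ) + 1) by positivity))
      exact frequently_atTop.1 h N
  choose t ht1 ht2 using hex
  let g : ℕ → ℕ := fun N => ∑ i, ∑ l ∈ Finset.range (N + 1), t i l N
  let f : ℕ → ℕ → ℕ := fun k M => M * k + M + g (M * k + k)
  let M : ℕ → ℕ := fun k => Nat.rec 0 (fun k M => M + (f k M + 1)) k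
  have hM : ∀ k, M (k + 1) = M k + (f k (M k) + 1) := fun k => rfl
  refine ⟨fun k => f k (M k), M, strictMono_nat_of_lt_succ fun k => ?_, rfl, hM, fun k => ?_,
    fun i l => ?_⟩
  · have h1 := hM k
    have h2 : M (k + 1) ≤ f (k + 1) (M (k + 1)) := by simp only [f]; omega
    omega
  · simp only [f]; omega
  · refine eventually_atTop.2 ⟨l, fun k hk => ⟨t i l (M k * k + k), ht1 _ _ _, ?_, ?_⟩⟩
    · have h1 : t i l (M k * k + k) ≤ ∑ l ∈ Finset.range (M k * k + k + 1), t i l (M k * k + k) :=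
        Finset.single_le_sum (f := fun l => t i l (M k * k + k)) (fun _ _ => Nat.zero_le _)
          (Finset.mem_range.2 (by omega))
      have h2 : ∑ l ∈ Finset.range (M k * k + k + 1), t i l (M k * k + k) ≤ g (M k * k + k) :=
        Finset.single_le_sum
          (f := fun i => ∑ l ∈ Finset.range (M k * k + k + 1), t i l (M k * k + k))
          (fun _ _ => Nat.zero_le _) (Finset.mem_univ i)
      simp only [f]; omega
    · refine (ht2 i l _).le.trans ?_
      gcongr
      exact Nat.le_add_left _ _

/-- Given finitely many sequences `S 1, …, S m`, there is a single
increasing sequence `n₁ < n₂ < n₃ < …` such that for every `i`, the concatenation of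
prefixes `T_i = S_i[0…n₁]S_i[0…n₂]S_i[0…n₃]…` satisfies `dim_FS(T_i) = dim_FS(S_i)`. -/
theorem stmt4 {α : Type*} [Fintype α] [DecidableEq α] [Inhabited α]
    (hα : 2 ≤ Fintype.card α) (m : ℕ) (S : Fin m → (ℕ → α)) :
    ∃ n : ℕ → ℕ, StrictMono n ∧
      ∀ i : Fin m, dimFS (concatSeq default (fun j => pre (S i) (n j))) = dimFS (S i) := by
  obtain ⟨n, M, hn, hM0, hM, hMn, hlow⟩ := exists_fast_growing
    (fun i l => freqSum (entropyTerm (Fintype.card α) (l + 1))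
      (fun N (w : Fin (l + 1) → α) => windowCount (S i) N w))
    (fun i l => isCoboundedUnder_ge_freqSum (continuous_entropyTerm _ _)
      fun N w => windowCount_le (S i) N w)
  refine ⟨n, hn, fun i => ?_⟩
  have hcum : ∀ k, cumLen (fun j => pre (S i) (n j)) k = M k := by
    intro k
    induction k with
    | zero => rw [hM0, cumLen]
    | succ k ih => rw [cumLen, ih, hM]; simp [pre]
  rw [dimFS_eq_iInf_freqSum, dimFS_eq_iInf_freqSum]
  refine iInf_congr fun l => ?_
  refine liminf_freqSum_concat (l := l + 1) (concaveOn_entropyTerm _ _)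
    (continuous_entropyTerm _ _) (fun x hx => entropyTerm_nonneg _ _ hx)
    (fun N w => windowCount_le _ N w) (fun N w => windowCount_le _ N w) hM0 hM hn hMn ?_ (hlow i l)
  intro k m w hm
  refine abs_windowCount_sub_le (S i) _ (fun j hj => ?_) hm w
  rw [← hcum]
  exact concatSeq_pre default (S i) n hj
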